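/- Consider list colorings on a finite simple graph G = (V,E) of maximum degree Δ ≥ 3, where each vertex v has a color list L_v with deg_G(v) + 2 ≤ |L_v| ≤ q. Let k ≥ 1 and let B ⊆ V be nonempty with |B| ≤ k. Then for every pinning η on V∖B, the conditional distribution μ^η_B over list colorings of B satisfies approximate tensorization of variance with constant C = (2^Δ q)^{k−1}; that is, for every real-valued function f of the coloring of B, Var_{μ^η_B} f ≤ (2^Δ q)^{k−1} · Σ_{v∈B} E[Var_v f], where the conditional variances are taken under μ^η_B. -/

import Mathlib

open scoped BigOperators Classical

noncomputable section

/-- Expectation of `f` under the (finitely supported) density `p`. -/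
def pmean {α : Type*} [Fintype α] (p f : α → ℝ) : ℝ := ∑ a, p a * f a

/-- Variance of `f` under the density `p`. -/
def pvar {α : Type*} [Fintype α] (p f : α → ℝ) : ℝ :=
  pmean p (fun a => (f a - pmean p f) ^ 2)

variable {V : Type*} [Fintype V] [DecidableEq V] {C : Type*} [Fintype C] [DecidableEq C]

/-- The degree of `v` in `G`. -/
def gdeg (G : SimpleGraph V) (v : V) : ℕ :=
  (Finset.univ.filter (fun u => G.Adj v u)).card

/-- `σ` is a proper list coloring: each vertex gets a color from its own list and
adjacent vertices get distinct colors. -/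
def isListColoring (G : SimpleGraph V) (L : V → Finset C) (σ : V → C) : Prop :=
  (∀ v, σ v ∈ L v) ∧ ∀ u v, G.Adj u v → σ u ≠ σ v

/-- The uniform distribution over the proper list colorings of `G`. -/
def colMu (G : SimpleGraph V) (L : V → Finset C) : (V → C) → ℝ :=
  fun σ => (if isListColoring G L σ then 1 else 0) /
    ((Finset.univ.filter (fun τ : V → C => isListColoring G L τ)).card : ℝ)

/-- The conditional density of `μ` given that the configuration agrees with `σ`
outside the (free) set `B`. -/
def condD (μ : (V → C) → ℝ) (B : Finset V) (σ : V → C) : (V → C) → ℝ :=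
  fun τ => if ∀ v, v ∉ B → τ v = σ v
    then μ τ / ∑ τ' ∈ Finset.univ.filter (fun τ' : V → C => ∀ v, v ∉ B → τ' v = σ v), μ τ'
    else 0

open Finset Function

section FiniteVariance

variable {X : Type*}

/-- The average of `f` over the finite set `S`, with value `0` when `S` is empty. -/
def unifAvg (S : Finset X) (f : X → ℝ) : ℝ := (∑ x ∈ S, f x) / (S.card : ℝ)

/-- The sum over `S` of the squared deviations of `f` from its average on `S`. -/
def sqDev (S : Finset X) (f : X → ℝ) : ℝ := ∑ x ∈ S, (f x - unifAvg S f) ^ 2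

theorem sqDev_nonneg (S : Finset X) (f : X → ℝ) : 0 ≤ sqDev S f :=
  sum_nonneg fun _ _ => sq_nonneg _

theorem card_mul_unifAvg (S : Finset X) (f : X → ℝ) :
    (S.card : ℝ) * unifAvg S f = ∑ x ∈ S, f x := by
  rcases S.eq_empty_or_nonempty with rfl | h
  · simp [unifAvg]
  · have : (S.card : ℝ) ≠ 0 := by exact_mod_cast h.card_pos.ne'
    unfold unifAvg
    field_simp

theorem sum_sub_unifAvg (S : Finset X) (f : X → ℝ) : ∑ x ∈ S, (f x - unifAvg S f) = 0 := by
  simp [sum_sub_distrib, card_mul_unifAvg]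

theorem sum_sq_sub_const (S : Finset X) (f : X → ℝ) (a : ℝ) :
    ∑ x ∈ S, (a - f x) ^ 2 = sqDev S f + (S.card : ℝ) * (a - unifAvg S f) ^ 2 := by
  have h : ∀ x ∈ S, (a - f x) ^ 2 = (f x - unifAvg S f) ^ 2 + (a - unifAvg S f) ^ 2
      - 2 * (a - unifAvg S f) * (f x - unifAvg S f) := fun x _ => by ring
  rw [sum_congr rfl h, sum_sub_distrib, sum_add_distrib, ← mul_sum, sum_sub_unifAvg]
  simp [sqDev]

theorem sum_sum_sq_sub (A A' : Finset X) (f : X → ℝ) :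
    ∑ x ∈ A, ∑ y ∈ A', (f x - f y) ^ 2 =
      (A'.card : ℝ) * sqDev A f + (A.card : ℝ) * sqDev A' f +
        (A.card : ℝ) * A'.card * (unifAvg A f - unifAvg A' f) ^ 2 := by
  simp_rw [sum_sq_sub_const]
  rw [sum_add_distrib, ← mul_sum]
  have h : ∑ x ∈ A, (f x - unifAvg A' f) ^ 2 = ∑ x ∈ A, (unifAvg A' f - f x) ^ 2 :=
    sum_congr rfl fun x _ => by ring
  rw [h, sum_sq_sub_const, sum_const, nsmul_eq_mul]
  ring

theorem card_mul_sq_unifAvg_sub_le {A A' T : Finset X} (f : X → ℝ) (φ : X → X) (hT : T ⊆ A)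
    (hφ : ∀ x ∈ T, φ x ∈ A') (hinj : Set.InjOn φ T) :
    (T.card : ℝ) * (unifAvg A f - unifAvg A' f) ^ 2 ≤
      3 * (sqDev A f + sqDev A' f + ∑ x ∈ T, (f x - f (φ x)) ^ 2) := by
  have h1 : ∑ x ∈ T, (f x - unifAvg A f) ^ 2 ≤ sqDev A f :=
    sum_le_sum_of_subset_of_nonneg hT fun _ _ _ => sq_nonneg _
  have h2 : ∑ x ∈ T, (f (φ x) - unifAvg A' f) ^ 2 ≤ sqDev A' f := by
    rw [← sum_image (f := fun y => (f y - unifAvg A' f) ^ 2) hinj]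
    exact sum_le_sum_of_subset_of_nonneg (image_subset_iff.2 hφ) fun _ _ _ => sq_nonneg _
  have h3 : ∑ _x ∈ T, (unifAvg A f - unifAvg A' f) ^ 2 ≤
      ∑ x ∈ T, 3 * ((f x - unifAvg A f) ^ 2 + (f (φ x) - unifAvg A' f) ^ 2 +
        (f x - f (φ x)) ^ 2) := by
    refine sum_le_sum fun x _ => ?_
    nlinarith [sq_nonneg ((unifAvg A f - f x) - (f x - f (φ x))),
      sq_nonneg ((unifAvg A f - f x) - (f (φ x) - unifAvg A' f)),
      sq_nonneg ((f x - f (φ x)) - (f (φ x) - unifAvg A' f))]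
  rw [sum_const, nsmul_eq_mul, ← mul_sum, sum_add_distrib, sum_add_distrib] at h3
  linarith

theorem sum_sum_sq_sub_le {A A' T : Finset X} (f : X → ℝ) (φ : X → X) (hT : T ⊆ A)
    (hφ : ∀ x ∈ T, φ x ∈ A') (hinj : Set.InjOn φ T) {r N : ℝ} (hr : 0 ≤ r)
    (hA : A'.Nonempty → (A.card : ℝ) ≤ r * T.card)
    (hA' : A.Nonempty → (A'.card : ℝ) ≤ r * T.card) (hN : (A'.card : ℝ) ≤ N) :
    ∑ x ∈ A, ∑ y ∈ A', (f x - f y) ^ 2 ≤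
      (1 + 3 * r) * ((A'.card : ℝ) * sqDev A f + (A.card : ℝ) * sqDev A' f) +
        3 * r * N * ∑ x ∈ T, (f x - f (φ x)) ^ 2 := by
  have hE : 0 ≤ ∑ x ∈ T, (f x - f (φ x)) ^ 2 := sum_nonneg fun _ _ => sq_nonneg _
  have hS := sqDev_nonneg A f
  have hS' := sqDev_nonneg A' f
  rcases A.eq_empty_or_nonempty with rfl | hne
  · have : 0 ≤ N := le_trans (Nat.cast_nonneg _) hN
    simp only [sum_empty]
    positivity
  rcases A'.eq_empty_or_nonempty with rfl | hne'
  · have : 0 ≤ N := le_trans (Nat.cast_nonneg _) hN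
    simp only [sum_empty, sum_const_zero]
    positivity
  have key := card_mul_sq_unifAvg_sub_le f φ hT hφ hinj
  rw [sum_sum_sq_sub]
  set a := (unifAvg A f - unifAvg A' f) ^ 2
  set E := ∑ x ∈ T, (f x - f (φ x)) ^ 2
  have ha : 0 ≤ a := sq_nonneg _
  set m : ℝ := min (A.card : ℝ) A'.card with hm
  have hm0 : 0 ≤ m := le_min (Nat.cast_nonneg _) (Nat.cast_nonneg _)
  have hcard : (A.card : ℝ) * A'.card ≤ r * T.card * m := by
    rcases le_total (A.card : ℝ) A'.card with h | h
    · rw [hm, min_eq_left h, mul_comm]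
      exact mul_le_mul_of_nonneg_right (hA' hne) (Nat.cast_nonneg _)
    · rw [hm, min_eq_right h]
      exact mul_le_mul_of_nonneg_right (hA hne') (Nat.cast_nonneg _)
  have h1 : (A.card : ℝ) * A'.card * a ≤ r * m * (3 * (sqDev A f + sqDev A' f + E)) :=
    calc (A.card : ℝ) * A'.card * a ≤ r * T.card * m * a :=
          mul_le_mul_of_nonneg_right hcard ha
      _ = r * m * (T.card * a) := by ring
      _ ≤ _ := mul_le_mul_of_nonneg_left key (by positivity)
  have h2 : m * sqDev A f ≤ A'.card * sqDev A f :=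
    mul_le_mul_of_nonneg_right (min_le_right _ _) hS
  have h3 : m * sqDev A' f ≤ A.card * sqDev A' f :=
    mul_le_mul_of_nonneg_right (min_le_left _ _) hS'
  have h4 : m * E ≤ N * E := mul_le_mul_of_nonneg_right ((min_le_right _ _).trans hN) hE
  have h5 := mul_le_mul_of_nonneg_left (add_le_add (add_le_add h2 h3) h4) hr
  nlinarith

end FiniteVariance

section Extensions

variable {V : Type*} [Fintype V] [DecidableEq V] {C : Type*} [Fintype C] [DecidableEq C]
  {G : SimpleGraph V} {L : V → Finset C}

/-- The proper list colorings that agree with `η` outside `B`. -/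
def extensions (G : SimpleGraph V) (L : V → Finset C) (B : Finset V) (η : V → C) :
    Finset (V → C) :=
  univ.filter fun τ => isListColoring G L τ ∧ ∀ v, v ∉ B → τ v = η v

theorem mem_extensions {B : Finset V} {η τ : V → C} :
    τ ∈ extensions G L B η ↔ isListColoring G L τ ∧ ∀ v, v ∉ B → τ v = η v := by
  simp [extensions]

theorem condD_colMu (B : Finset V) (η τ : V → C) :
    condD (colMu G L) B η τ =
      if τ ∈ extensions G L B η then ((extensions G L B η).card : ℝ)⁻¹ else 0 := by
  unfold condD colMu
  rw [← sum_div, sum_boole, filter_filter]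
  have hS : (univ.filter fun a : V → C => (∀ v, v ∉ B → a v = η v) ∧ isListColoring G L a) =
      extensions G L B η := by
    ext a
    simp [mem_extensions, and_comm]
  rw [hS]
  by_cases hc : isListColoring G L τ
  · have hN : ((univ.filter fun τ : V → C => isListColoring G L τ).card : ℝ) ≠ 0 := by
      have : (univ.filter fun τ : V → C => isListColoring G L τ).Nonempty := ⟨τ, by simp [hc]⟩
      exact_mod_cast this.card_pos.ne'
    by_cases ha : ∀ v, v ∉ B → τ v = η v
    · rw [if_pos ha, if_pos hc, if_pos (mem_extensions.2 ⟨hc, ha⟩),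
        div_div_div_cancel_right₀ hN, one_div]
    · rw [if_neg ha, if_neg fun h => ha (mem_extensions.1 h).2]
  · rw [if_neg fun h => hc (mem_extensions.1 h).1]
    simp [hc]

theorem pmean_condD_colMu (B : Finset V) (η : V → C) (f : (V → C) → ℝ) :
    pmean (condD (colMu G L) B η) f = unifAvg (extensions G L B η) f := by
  unfold pmean unifAvg
  simp_rw [condD_colMu, ite_mul, zero_mul]
  rw [sum_ite_mem, univ_inter, ← mul_sum, div_eq_inv_mul]

theorem pvar_condD_colMu (B : Finset V) (η : V → C) (f : (V → C) → ℝ) :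
    pvar (condD (colMu G L) B η) f =
      sqDev (extensions G L B η) f / (extensions G L B η).card := by
  unfold pvar
  rw [pmean_condD_colMu, pmean_condD_colMu]
  rfl

theorem isListColoring_update {V C : Type*} [DecidableEq V] {G : SimpleGraph V}
    {L : V → Finset C} {σ : V → C} (hσ : isListColoring G L σ) {u : V} {a : C}
    (ha : a ∈ L u) (hN : ∀ w, G.Adj u w → σ w ≠ a) : isListColoring G L (update σ u a) := by
  refine ⟨fun w => ?_, fun x y hxy => ?_⟩
  · by_cases h : w = u
    · subst h; simpa using ha
    · simpa [h] using hσ.1 w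
  · by_cases hx : x = u
    · subst hx
      have hy : y ≠ x := hxy.ne'
      simpa [hy] using (hN y hxy).symm
    · by_cases hy : y = u
      · subst hy
        simpa [hx] using hN x hxy.symm
      · simpa [hx, hy] using hσ.2 x y hxy

theorem exists_recolor {V C : Type*} [Fintype V] [DecidableEq C] {G : SimpleGraph V}
    {L : V → Finset C} {u : V} (hL : gdeg G u + 2 ≤ (L u).card) (σ : V → C) (c : C) :
    ∃ a ∈ L u, a ≠ c ∧ ∀ w, G.Adj u w → σ w ≠ a := by
  set F : Finset C := insert c ((univ.filter fun w => G.Adj u w).image σ) with hF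
  have hcard : F.card < (L u).card := by
    have h1 : F.card ≤ _ + 1 := card_insert_le _ _
    have h2 : ((univ.filter fun w => G.Adj u w).image σ).card ≤ gdeg G u := card_image_le
    omega
  obtain ⟨a, ha, haF⟩ := exists_mem_notMem_of_card_lt_card hcard
  simp only [hF, mem_insert, mem_image, mem_filter, mem_univ, true_and, not_or, not_exists,
    not_and] at haF
  exact ⟨a, ha, haF.1, haF.2⟩

theorem filter_extensions_insert {B : Finset V} {v : V} (hv : v ∉ B) (η : V → C) (c : C) :
    (extensions G L (insert v B) η).filter (fun σ => σ v = c) =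
      extensions G L B (update η v c) := by
  ext σ
  simp only [mem_filter, mem_extensions, mem_insert, not_or]
  constructor
  · rintro ⟨⟨h1, h2⟩, h3⟩
    refine ⟨h1, fun w hw => ?_⟩
    by_cases h : w = v
    · subst h; simpa using h3
    · simpa [h] using h2 w ⟨h, hw⟩
  · rintro ⟨h1, h2⟩
    exact ⟨⟨h1, fun w hw => by simpa [hw.1] using h2 w hw.2⟩, by simpa using h2 v hv⟩

theorem card_extensions_le_avoiding (hL : ∀ v, gdeg G v + 2 ≤ (L v).card) {B : Finset V}
    (η : V → C) (c : C) {A : Finset V} (hA : A ⊆ B) :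
    (extensions G L B η).card ≤
      2 ^ A.card * ((extensions G L B η).filter fun σ => ∀ u ∈ A, σ u ≠ c).card := by
  induction A using Finset.induction_on with
  | empty => simp
  | insert u A hu ih =>
    refine (ih ((subset_insert _ _).trans hA)).trans ?_
    rw [card_insert_of_notMem hu, pow_succ, mul_assoc]
    refine Nat.mul_le_mul_left _ ?_
    set F := (extensions G L B η).filter fun σ => ∀ u ∈ A, σ u ≠ c with hF
    have hgood : ((extensions G L B η).filter fun σ => ∀ w ∈ insert u A, σ w ≠ c) =
        F.filter fun σ => ¬ σ u = c := by
      ext σ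
      simp only [hF, mem_filter, mem_insert, forall_eq_or_imp]
      tauto
    rw [hgood, ← card_filter_add_card_filter_not (s := F) fun σ => σ u = c, two_mul]
    refine Nat.add_le_add_right ?_ _
    choose a haL hac haN using fun σ : V → C => exists_recolor (hL u) σ c
    refine card_le_card_of_injOn (fun σ => update σ u (a σ)) ?_ ?_
    · intro σ hσ
      simp only [hF, coe_filter, mem_filter, mem_extensions, Set.mem_ofPred_eq] at hσ ⊢
      obtain ⟨⟨⟨h1, h2⟩, h3⟩, -⟩ := hσ
      refine ⟨⟨⟨isListColoring_update h1 (haL σ) (haN σ), fun w hw => ?_⟩, fun w hw => ?_⟩, ?_⟩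
      · have : w ≠ u := fun h => hw (h ▸ hA (mem_insert_self _ _))
        simpa [this] using h2 w hw
      · have : w ≠ u := fun h => hu (h ▸ hw)
        simpa [this] using h3 w hw
      · simpa using hac σ
    · intro σ hσ σ' hσ' h
      simp only [coe_filter, Set.mem_ofPred_eq] at hσ hσ'
      funext w
      by_cases hw : w = u
      · subst hw; rw [hσ.2, hσ'.2]
      · simpa [hw] using congrFun h w

/-- Recoloring `v` from `c` to `c'` is possible for at least a `2 ^ (-d)` fraction of the
extensions, where `d` is the number of neighbors of `v` in `B`. -/
theorem card_extensions_le_recolorable (hL : ∀ v, gdeg G v + 2 ≤ (L v).card) {B : Finset V}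
    {v : V} (η : V → C) (c c' : C)
    (hne : (extensions G L B (update η v c')).Nonempty) (hv : v ∉ B) :
    (extensions G L B (update η v c)).card ≤ 2 ^ (B.filter fun u => G.Adj v u).card *
      ((extensions G L B (update η v c)).filter
        fun σ => isListColoring G L (update σ v c')).card := by
  refine (card_extensions_le_avoiding hL _ c'
    (filter_subset (fun u => G.Adj v u) B)).trans ?_
  refine Nat.mul_le_mul_left _ (card_le_card ?_)
  obtain ⟨ρ, hρ⟩ := hne
  rw [mem_extensions] at hρ
  have hρv : ρ v = c' := by simpa using hρ.2 v hv
  intro σ hσ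
  simp only [mem_filter, mem_extensions, and_imp] at hσ ⊢
  obtain ⟨⟨h1, h2⟩, h3⟩ := hσ
  refine ⟨⟨h1, h2⟩, isListColoring_update h1 (hρv ▸ hρ.1.1 v) fun w hw => ?_⟩
  by_cases hwB : w ∈ B
  · exact h3 w hwB hw
  · have hwv : w ≠ v := hw.ne'
    have e : σ w = ρ w := by
      rw [h2 w hwB, hρ.2 w hwB]
      simp [hwv]
    rw [e, ← hρv]
    exact hρ.1.2 w v hw.symm

theorem update_mem_extensions {B : Finset V} {v : V} {η σ : V → C} {c c' : C}
    (hσ : σ ∈ (extensions G L B (update η v c)).filter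
      fun σ => isListColoring G L (update σ v c')) :
    update σ v c' ∈ extensions G L B (update η v c') := by
  simp only [mem_filter, mem_extensions] at hσ ⊢
  refine ⟨hσ.2, fun w hw => ?_⟩
  by_cases h : w = v
  · subst h; simp
  · simpa [h] using hσ.1.2 w hw

theorem injOn_update_extensions {B : Finset V} {v : V} (hv : v ∉ B) (η : V → C) (c c' : C) :
    Set.InjOn (fun σ : V → C => update σ v c')
      (extensions G L B (update η v c) : Set (V → C)) := by
  intro σ hσ σ' hσ' h
  have h1 := (mem_extensions.1 (mem_coe.1 hσ)).2 v hv
  have h2 := (mem_extensions.1 (mem_coe.1 hσ')).2 v hv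
  funext w
  by_cases hw : w = v
  · subst hw; rw [h1, h2]
  · simpa [hw] using congrFun h w

theorem card_recolorable_le {B : Finset V} {v : V} (hv : v ∉ B) (η : V → C) (c c' : C) :
    ((extensions G L B (update η v c)).filter
        fun σ => isListColoring G L (update σ v c')).card ≤
      ((extensions G L B (update η v c')).filter
        fun σ => isListColoring G L (update σ v c)).card := by
  refine card_le_card_of_injOn (fun σ => update σ v c') ?_
    ((injOn_update_extensions hv η c c').mono (filter_subset _ _))
  intro σ hσ
  have hσ' := mem_coe.1 hσ
  have h1 := (mem_extensions.1 (mem_filter.1 hσ').1)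
  have h2 : update σ v c = σ := by
    rw [update_eq_self_iff]
    simpa using (h1.2 v hv).symm
  rw [coe_filter]
  exact ⟨update_mem_extensions hσ', by simpa [h2] using h1.1⟩

theorem sum_extensions_singleton {σ : V → C} (v : V) (g : (V → C) → ℝ) :
    ∑ τ ∈ extensions G L {v} σ, g τ =
      ∑ c, if isListColoring G L (update σ v c) then g (update σ v c) else 0 := by
  rw [← sum_filter]
  symm
  refine sum_bij' (fun c _ => update σ v c) (fun τ _ => τ v) ?_ ?_ ?_ ?_ ?_
  · intro c hc
    exact mem_extensions.2 ⟨(mem_filter.1 hc).2, fun w hw => by simp_all⟩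
  · intro τ hτ
    rw [mem_extensions] at hτ
    have : update σ v (τ v) = τ := by
      funext w
      by_cases h : w = v
      · subst h; simp
      · simpa [h] using (hτ.2 w (by simpa using h)).symm
    simpa [this] using hτ.1
  · simp
  · intro τ hτ
    rw [mem_extensions] at hτ
    funext w
    by_cases h : w = v
    · subst h; simp
    · simpa [h] using (hτ.2 w (by simpa using h)).symm
  · simp

theorem extensions_singleton_congr {v : V} {σ τ : V → C} (h : τ ∈ extensions G L {v} σ) :
    extensions G L {v} τ = extensions G L {v} σ := by
  rw [mem_extensions] at h
  ext ρ
  simp only [mem_extensions]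
  refine and_congr_right fun _ => forall₂_congr fun w hw => ?_
  rw [h.2 w hw]

theorem mem_extensions_singleton_symm {v : V} {σ τ : V → C} (hσ : isListColoring G L σ)
    (h : τ ∈ extensions G L {v} σ) : σ ∈ extensions G L {v} τ := by
  rw [mem_extensions] at h ⊢
  exact ⟨hσ, fun w hw => (h.2 w hw).symm⟩

theorem mem_extensions_of_mem_singleton {B : Finset V} {v : V} (hv : v ∈ B) {η σ τ : V → C}
    (hσ : σ ∈ extensions G L B η) (h : τ ∈ extensions G L {v} σ) : τ ∈ extensions G L B η := by
  rw [mem_extensions] at *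
  refine ⟨h.1, fun w hw => ?_⟩
  rw [h.2 w (by simpa using fun e : w = v => hw (e ▸ hv)), hσ.2 w hw]

theorem sum_sum_singleton_sq_sub {B : Finset V} {v : V} (hv : v ∈ B) (η : V → C)
    (f : (V → C) → ℝ) :
    ∑ σ ∈ extensions G L B η, ∑ τ ∈ extensions G L {v} σ, (f σ - f τ) ^ 2 =
      2 * ∑ σ ∈ extensions G L B η, sqDev (extensions G L {v} σ) f := by
  simp_rw [sum_sq_sub_const]
  rw [sum_add_distrib, two_mul]
  congr 1
  have hcomm : ∀ σ τ, σ ∈ extensions G L B η ∧ τ ∈ extensions G L {v} σ ↔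
      σ ∈ extensions G L {v} τ ∧ τ ∈ extensions G L B η := fun σ τ =>
    ⟨fun ⟨h1, h2⟩ => ⟨mem_extensions_singleton_symm (mem_extensions.1 h1).1 h2,
      mem_extensions_of_mem_singleton hv h1 h2⟩,
    fun ⟨h1, h2⟩ => ⟨mem_extensions_of_mem_singleton hv h2 h1,
      mem_extensions_singleton_symm (mem_extensions.1 h2).1 h1⟩⟩
  have h1 : ∀ σ ∈ extensions G L B η, sqDev (extensions G L {v} σ) f =
      ∑ τ ∈ extensions G L {v} σ, (f τ - unifAvg (extensions G L {v} τ) f) ^ 2 :=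
    fun σ _ => sum_congr rfl fun τ hτ => by rw [extensions_singleton_congr hτ]
  rw [sum_congr rfl h1, sum_comm' hcomm]
  simp

/-- One step of the induction: splitting `insert v B` according to the color of `v`. -/
theorem sqDev_extensions_insert_le (hL : ∀ v, gdeg G v + 2 ≤ (L v).card) {B : Finset V} {v : V}
    (hv : v ∉ B) (η : V → C) (f : (V → C) → ℝ) :
    sqDev (extensions G L (insert v B) η) f ≤
      (1 + 3 * 2 ^ (B.filter fun u => G.Adj v u).card) *
          ∑ c, sqDev (extensions G L B (update η v c)) f +
        3 * 2 ^ (B.filter fun u => G.Adj v u).card *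
          ∑ σ ∈ extensions G L (insert v B) η, sqDev (extensions G L {v} σ) f := by
  set S := extensions G L (insert v B) η with hS
  set r : ℝ := 2 ^ (B.filter fun u => G.Adj v u).card with hr
  have hr0 : 0 ≤ r := by positivity
  rcases S.eq_empty_or_nonempty with h0 | hne
  · have h1 : sqDev S f = 0 := by simp [sqDev, h0]
    rw [h1]
    exact add_nonneg
      (mul_nonneg (by positivity) (sum_nonneg fun c _ => sqDev_nonneg _ _))
      (mul_nonneg (by positivity) (sum_nonneg fun σ _ => sqDev_nonneg _ _))
  have hfib : ∀ g : (V → C) → ℝ,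
      ∑ σ ∈ S, g σ = ∑ c, ∑ σ ∈ extensions G L B (update η v c), g σ := fun g => by
    rw [← sum_fiberwise S fun σ => σ v]
    exact sum_congr rfl fun c _ => by rw [hS, filter_extensions_insert hv]
  have hcard : (S.card : ℝ) = ∑ c, ((extensions G L B (update η v c)).card : ℝ) := by
    simpa using hfib fun _ => 1
  have hrec : ∀ c c', (extensions G L B (update η v c')).Nonempty →
      ((extensions G L B (update η v c)).card : ℝ) ≤
        r * ((extensions G L B (update η v c)).filter
          fun σ => isListColoring G L (update σ v c')).card := by
    intro c c' h
    rw [hr]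
    exact_mod_cast card_extensions_le_recolorable hL η c c' h hv
  have hpair : ∀ c c', ∑ x ∈ extensions G L B (update η v c),
      ∑ y ∈ extensions G L B (update η v c'), (f x - f y) ^ 2 ≤
      (1 + 3 * r) * (((extensions G L B (update η v c')).card : ℝ) *
          sqDev (extensions G L B (update η v c)) f +
        ((extensions G L B (update η v c)).card : ℝ) *
          sqDev (extensions G L B (update η v c')) f) +
        3 * r * S.card * ∑ x ∈ (extensions G L B (update η v c)).filter
          (fun σ => isListColoring G L (update σ v c')), (f x - f (update x v c')) ^ 2 := by
    intro c c'
    refine sum_sum_sq_sub_le f (fun σ => update σ v c') (filter_subset _ _)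
      (fun _ => update_mem_extensions)
      ((injOn_update_extensions hv η c c').mono (filter_subset _ _)) hr0 ?_ ?_ ?_
    · exact hrec c c'
    · exact fun h => (hrec c' c h).trans (mul_le_mul_of_nonneg_left
        (by exact_mod_cast card_recolorable_le hv η c' c) hr0)
    · rw [← filter_extensions_insert hv]
      exact_mod_cast card_filter_le _ _
  have hE : ∑ c, ∑ c', ∑ x ∈ (extensions G L B (update η v c)).filter
      (fun σ => isListColoring G L (update σ v c')), (f x - f (update x v c')) ^ 2 =
      2 * ∑ σ ∈ S, sqDev (extensions G L {v} σ) f := by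
    rw [hS, ← sum_sum_singleton_sq_sub (mem_insert_self v B), ← hS, hfib]
    refine sum_congr rfl fun c _ => ?_
    simp_rw [sum_extensions_singleton, sum_filter]
    exact sum_comm
  have hD : ∑ x ∈ S, ∑ y ∈ S, (f x - f y) ^ 2 =
      ∑ c, ∑ c', ∑ x ∈ extensions G L B (update η v c),
        ∑ y ∈ extensions G L B (update η v c'), (f x - f y) ^ 2 := by
    rw [hfib]
    refine sum_congr rfl fun c _ => ?_
    simp_rw [hfib]
    exact sum_comm
  have hle := sum_le_sum fun c (_ : c ∈ univ) => sum_le_sum fun c' (_ : c' ∈ univ) => hpair c c'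
  simp_rw [sum_add_distrib, ← mul_sum, sum_add_distrib, ← mul_sum, ← sum_mul, ← hcard] at hle
  rw [← hD, hE, sum_sum_sq_sub, ← mul_sum] at hle
  have hpos : (0 : ℝ) < S.card := by exact_mod_cast hne.card_pos
  refine le_of_mul_le_mul_left ?_ (mul_pos two_pos hpos)
  linarith

theorem sqDev_singleton_le {q : ℕ} {v : V} (hq : (L v).card ≤ q) (σ : V → C)
    (f : (V → C) → ℝ) :
    sqDev (extensions G L {v} σ) f ≤
      q * (sqDev (extensions G L {v} σ) f / (extensions G L {v} σ).card) := by
  rcases (extensions G L {v} σ).eq_empty_or_nonempty with h0 | hne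
  · simp [sqDev, h0]
  have hpos : (0 : ℝ) < (extensions G L {v} σ).card := by exact_mod_cast hne.card_pos
  have hcard : (extensions G L {v} σ).card ≤ q := by
    refine le_trans (card_le_card_of_injOn (fun τ => τ v) ?_ ?_) hq
    · intro τ hτ
      exact (mem_extensions.1 (mem_coe.1 hτ)).1.1 v
    · intro τ hτ τ' hτ' h
      funext w
      by_cases hw : w = v
      · subst hw; exact h
      · rw [(mem_extensions.1 (mem_coe.1 hτ)).2 w (by simpa using hw),
          (mem_extensions.1 (mem_coe.1 hτ')).2 w (by simpa using hw)]
  rw [mul_div_assoc', le_div_iff₀ hpos, mul_comm]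
  exact mul_le_mul_of_nonneg_right (by exact_mod_cast hcard) (sqDev_nonneg _ _)

theorem one_add_three_mul_two_pow_le {d Δ q : ℕ} (hΔ : 3 ≤ Δ) (hd : d ≤ Δ) (hq : d + 2 ≤ q) :
    1 + 3 * 2 ^ d ≤ 2 ^ Δ * q := by
  have h8 : 2 ^ 3 ≤ 2 ^ Δ := Nat.pow_le_pow_right two_pos hΔ
  have hdΔ : 2 ^ d ≤ 2 ^ Δ := Nat.pow_le_pow_right two_pos hd
  rcases le_or_gt 4 q with h | h
  · nlinarith
  · have : d ≤ 1 := by omega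
    interval_cases d <;> norm_num <;> nlinarith

theorem three_mul_two_pow_mul_le {d n Δ q : ℕ} (hΔ : 3 ≤ Δ) (hd : d ≤ Δ) (hdn : d ≤ n + 1)
    (hq : 2 ≤ q) : 3 * 2 ^ d * q ≤ (2 ^ Δ * q) ^ (n + 1) := by
  have h8 : 2 ^ 3 ≤ 2 ^ Δ := Nat.pow_le_pow_right two_pos hΔ
  have hdΔ : 2 ^ d ≤ 2 ^ Δ := Nat.pow_le_pow_right two_pos hd
  cases n with
  | zero =>
    have : 2 ^ d ≤ 2 ^ 1 := Nat.pow_le_pow_right two_pos hdn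
    rw [zero_add, pow_one]
    nlinarith
  | succ n =>
    have h16 : 3 ≤ 2 ^ Δ * q := by nlinarith
    calc 3 * 2 ^ d * q ≤ 3 * 2 ^ Δ * q := by gcongr
      _ ≤ (2 ^ Δ * q) * (2 ^ Δ * q) := by
        rw [mul_assoc]; exact Nat.mul_le_mul_right _ h16
      _ = (2 ^ Δ * q) ^ 2 := (sq _).symm
      _ ≤ _ := Nat.pow_le_pow_right (by omega) (by omega)

theorem sqDev_extensions_le {Δ q : ℕ} (hΔ : 3 ≤ Δ) (hdeg : ∀ v, gdeg G v ≤ Δ)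
    (hL : ∀ v, gdeg G v + 2 ≤ (L v).card ∧ (L v).card ≤ q) (f : (V → C) → ℝ) (n : ℕ) :
    ∀ (B : Finset V) (η : V → C), B.card = n + 1 →
      sqDev (extensions G L B η) f ≤ ((2 : ℝ) ^ Δ * q) ^ n *
        ∑ u ∈ B, ∑ σ ∈ extensions G L B η,
          sqDev (extensions G L {u} σ) f / (extensions G L {u} σ).card := by
  set w : V → (V → C) → ℝ := fun u σ =>
    sqDev (extensions G L {u} σ) f / (extensions G L {u} σ).card with hw
  have hw0 : ∀ u σ, 0 ≤ w u σ := fun u σ => div_nonneg (sqDev_nonneg _ _) (Nat.cast_nonneg _)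
  induction n with
  | zero =>
    intro B η hB
    obtain ⟨v, rfl⟩ := card_eq_one.1 hB
    rw [pow_zero, one_mul, sum_singleton]
    have h : ∀ σ ∈ extensions G L {v} η, w v σ =
        sqDev (extensions G L {v} η) f / (extensions G L {v} η).card := fun σ hσ => by
      simp only [hw, extensions_singleton_congr hσ]
    change _ ≤ ∑ σ ∈ extensions G L {v} η, w v σ
    rw [sum_congr rfl h, sum_const, nsmul_eq_mul]
    rcases (extensions G L {v} η).eq_empty_or_nonempty with h0 | hne
    · simp [sqDev, h0]
    · have hpos : (0 : ℝ) < (extensions G L {v} η).card := by exact_mod_cast hne.card_pos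
      rw [mul_div_cancel₀ _ hpos.ne']
  | succ n ih =>
    intro B' η hB
    obtain ⟨v, B, hv, rfl, hcB⟩ := card_eq_succ.1 hB
    set S := extensions G L (insert v B) η with hS
    set d := (B.filter fun u => G.Adj v u).card with hd
    have hdv : d ≤ gdeg G v := card_le_card (filter_subset_filter _ (subset_univ _))
    have hdn : d ≤ n + 1 := (card_filter_le _ _).trans hcB.le
    have hLv := hL v
    have hM1 : 1 + 3 * (2 : ℝ) ^ d ≤ 2 ^ Δ * q := by
      exact_mod_cast one_add_three_mul_two_pow_le hΔ (hdv.trans (hdeg v)) (by omega)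
    have hM2 : 3 * (2 : ℝ) ^ d * q ≤ (2 ^ Δ * q) ^ (n + 1) := by
      exact_mod_cast three_mul_two_pow_mul_le hΔ (hdv.trans (hdeg v)) hdn (by omega)
    have hfib : ∑ c, ∑ u ∈ B, ∑ σ ∈ extensions G L B (update η v c), w u σ =
        ∑ u ∈ B, ∑ σ ∈ S, w u σ := by
      rw [sum_comm]
      refine sum_congr rfl fun u _ => ?_
      rw [← sum_fiberwise S fun σ => σ v]
      exact sum_congr rfl fun c _ => by rw [hS, filter_extensions_insert hv]
    have hW0 : 0 ≤ ∑ u ∈ B, ∑ σ ∈ S, w u σ :=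
      sum_nonneg fun u _ => sum_nonneg fun σ _ => hw0 u σ
    have hWv : 0 ≤ ∑ σ ∈ S, w v σ := sum_nonneg fun σ _ => hw0 v σ
    have h1 : ∑ c, sqDev (extensions G L B (update η v c)) f ≤
        ((2 : ℝ) ^ Δ * q) ^ n * ∑ u ∈ B, ∑ σ ∈ S, w u σ := by
      rw [← hfib, mul_sum]
      exact sum_le_sum fun c _ => ih B (update η v c) hcB
    have h2 : ∑ σ ∈ S, sqDev (extensions G L {v} σ) f ≤ q * ∑ σ ∈ S, w v σ := by
      rw [mul_sum]
      exact sum_le_sum fun σ _ => sqDev_singleton_le hLv.2 σ f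
    rw [sum_insert hv]
    have hd0 : (0 : ℝ) ≤ 2 ^ d := by positivity
    have hM0 : (0 : ℝ) ≤ (2 ^ Δ * q) ^ n := by positivity
    calc sqDev S f ≤ _ := sqDev_extensions_insert_le (fun v => (hL v).1) hv η f
      _ ≤ (1 + 3 * 2 ^ d) * (((2 : ℝ) ^ Δ * q) ^ n * ∑ u ∈ B, ∑ σ ∈ S, w u σ) +
          3 * 2 ^ d * (q * ∑ σ ∈ S, w v σ) :=
        add_le_add (mul_le_mul_of_nonneg_left h1 (by linarith))
          (mul_le_mul_of_nonneg_left h2 (by linarith))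
      _ = (1 + 3 * 2 ^ d) * (((2 : ℝ) ^ Δ * q) ^ n * ∑ u ∈ B, ∑ σ ∈ S, w u σ) +
          3 * 2 ^ d * q * ∑ σ ∈ S, w v σ := by ring
      _ ≤ (2 ^ Δ * q) * (((2 : ℝ) ^ Δ * q) ^ n * ∑ u ∈ B, ∑ σ ∈ S, w u σ) +
          (2 ^ Δ * q) ^ (n + 1) * ∑ σ ∈ S, w v σ :=
        add_le_add (mul_le_mul_of_nonneg_right hM1 (mul_nonneg hM0 hW0))
          (mul_le_mul_of_nonneg_right hM2 hWv)
      _ = _ := by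
        simp only [hw]
        ring

end Extensions

/-- **Approximate tensorization of variance for list colorings on a small set.**
If `Δ ≥ 3` bounds the maximum degree, `deg(v) + 2 ≤ |L_v| ≤ q`, and `B ⊆ V` is nonempty
with `|B| ≤ k`, then for any pinning `η` on `V ∖ B`, the conditional distribution
`μ^η_B` satisfies approximate tensorization of variance with constant `(2^Δ q)^{k-1}`. -/
theorem list_coloring_tensorization_of_variance
    {V : Type*} [Fintype V] [DecidableEq V] {C : Type*} [Fintype C] [DecidableEq C]
    (G : SimpleGraph V) (L : V → Finset C) (Δ q : ℕ) (hΔ : 3 ≤ Δ)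
    (hdeg : ∀ v, gdeg G v ≤ Δ)
    (hL : ∀ v, gdeg G v + 2 ≤ (L v).card ∧ (L v).card ≤ q)
    (k : ℕ) (hk : 1 ≤ k) (B : Finset V) (hBne : B.Nonempty) (hB : B.card ≤ k)
    (η : V → C) (hη : ∃ σ : V → C, isListColoring G L σ ∧ ∀ v, v ∉ B → σ v = η v)
    (f : (V → C) → ℝ) :
    pvar (condD (colMu G L) B η) f ≤
      ((2 : ℝ) ^ Δ * q) ^ (k - 1) *
        ∑ v ∈ B, pmean (condD (colMu G L) B η)
          (fun σ => pvar (condD (colMu G L) {v} σ) f) := by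
  simp_rw [pvar_condD_colMu, pmean_condD_colMu, unifAvg]
  rw [← sum_div, mul_div_assoc']
  refine div_le_div_of_nonneg_right ?_ (Nat.cast_nonneg _)
  have hpos := hBne.card_pos
  refine (sqDev_extensions_le hΔ hdeg hL f (B.card - 1) B η (by omega)).trans ?_
  refine mul_le_mul_of_nonneg_right (pow_le_pow_right₀ ?_ (by omega))
    (sum_nonneg fun u _ => sum_nonneg fun σ _ =>
      div_nonneg (sqDev_nonneg _ _) (Nat.cast_nonneg _))
  obtain ⟨v, -⟩ := hBne
  have hq : 1 ≤ q := by have := hL v; omega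
  exact one_le_mul_of_one_le_of_one_le (one_le_pow₀ one_le_two) (by exact_mod_cast hq)

end
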